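/- Let n > 1 and let L be the second order cone in ℝ^n. A symmetric matrix X ∈ ℝ^{n×n} is copositive on L (i.e., xᵀXx ≥ 0 for all x ∈ L) if and only if there exists μ ≥ 0 such that X − μJ is positive semidefinite, where J = diag(1,−1,…,−1). Equivalently, E_L = S^n_+ + ℝ₊·J. -/

import Mathlib

open Matrix

noncomputable section

/-- The second order cone in `ℝⁿ`: `{(t,u) : t ≥ ‖u‖}` (first coordinate is `t`). -/
def soc (n : ℕ) [NeZero n] : Set (Fin n → ℝ) :=
  {x | Real.sqrt (∑ i, if i = 0 then 0 else (x i) ^ 2) ≤ x 0}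

/-- The boundary of the second order cone: `{(t,u) : t = ‖u‖}`. -/
def socBd (n : ℕ) [NeZero n] : Set (Fin n → ℝ) :=
  {x | Real.sqrt (∑ i, if i = 0 then 0 else (x i) ^ 2) = x 0}

/-- `J = diag(1, -1, …, -1)`. -/
def Jmat (n : ℕ) [NeZero n] : Matrix (Fin n) (Fin n) ℝ :=
  Matrix.diagonal (fun i => if i = 0 then 1 else -1)

/-- The dual cone of a set `K ⊆ ℝⁿ`. -/
def dualCone {n : ℕ} (K : Set (Fin n → ℝ)) : Set (Fin n → ℝ) :=
  {y | ∀ x ∈ K, 0 ≤ x ⬝ᵥ y}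

/-- `A` is a Z-transformation on `K`: `x ∈ K`, `y ∈ K*`, `⟨x,y⟩ = 0` imply `⟨Ax,y⟩ ≤ 0`. -/
def IsZTransf {n : ℕ} (K : Set (Fin n → ℝ)) (A : Matrix (Fin n) (Fin n) ℝ) : Prop :=
  ∀ x ∈ K, ∀ y ∈ dualCone K, x ⬝ᵥ y = 0 → (A.mulVec x) ⬝ᵥ y ≤ 0

/-- The completely positive cone of `C`: all finite sums `∑ uᵢuᵢᵀ` with `uᵢ ∈ C`. -/
def cpCone {n : ℕ} (C : Set (Fin n → ℝ)) : Set (Matrix (Fin n) (Fin n) ℝ) :=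
  {X | ∃ (m : ℕ) (u : Fin m → Fin n → ℝ), (∀ i, u i ∈ C) ∧ X = ∑ i, vecMulVec (u i) (u i)}

/-- The copositive cone of `C`: symmetric matrices `A` with `xᵀAx ≥ 0` for all `x ∈ C`. -/
def copCone {n : ℕ} (C : Set (Fin n → ℝ)) : Set (Matrix (Fin n) (Fin n) ℝ) :=
  {A | Aᵀ = A ∧ ∀ x ∈ C, 0 ≤ x ⬝ᵥ A.mulVec x}

/-- `Ω = {(x,y) ∈ L × L : ‖x‖ = 1 = ‖y‖, ⟨x,y⟩ = 0}`. -/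
def OmegaSet (n : ℕ) [NeZero n] : Set ((Fin n → ℝ) × (Fin n → ℝ)) :=
  {p | p.1 ∈ soc n ∧ p.2 ∈ soc n ∧ Real.sqrt (∑ i, p.1 i ^ 2) = 1 ∧
       Real.sqrt (∑ i, p.2 i ^ 2) = 1 ∧ p.1 ⬝ᵥ p.2 = 0}

/-- `γ(A) = max {⟨Ax,y⟩ : (x,y) ∈ Ω}`. -/
def gammaFun (n : ℕ) [NeZero n] (A : Matrix (Fin n) (Fin n) ℝ) : ℝ :=
  sSup {r | ∃ p ∈ OmegaSet n, r = (A.mulVec p.1) ⬝ᵥ p.2}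

/-- **S-lemma** for real quadratic forms: if `f` is nonnegative wherever `g` is, and `g` takes a
positive value, then `f` dominates a nonnegative multiple of `g`. -/
theorem QuadraticForm.exists_nonneg_mul_le {V : Type*} [AddCommGroup V] [Module ℝ V]
    (f g : QuadraticForm ℝ V) (h : ∀ x, 0 ≤ g x → 0 ≤ f x) (hg : ∃ x, 0 < g x) :
    ∃ μ : ℝ, 0 ≤ μ ∧ ∀ x, μ * g x ≤ f x := by
  have expand (q : QuadraticForm ℝ V) (s : ℝ) (x y : V) :
      q (s • x + y) = s * s * q x + s * QuadraticMap.polar q x y + q y := by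
    rw [QuadraticMap.map_add q, QuadraticMap.map_smul, QuadraticMap.polar_smul_left]
    simp only [smul_eq_mul]
    ring
  have key (x y : V) (hx : 0 < g x) (hy : g y < 0) : f y / g y ≤ f x / g x := by
    set b := QuadraticMap.polar g x y with hb
    set D := Real.sqrt (b ^ 2 - 4 * g x * g y) with hD
    have hpos : 0 < b ^ 2 - 4 * g x * g y := by nlinarith [mul_pos hx (neg_pos.2 hy), sq_nonneg b]
    have hD0 : 0 < D := Real.sqrt_pos.2 hpos
    have hDsq : D ^ 2 = b ^ 2 - 4 * g x * g y := Real.sq_sqrt hpos.le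
    obtain ⟨s, hs⟩ : ∃ s, s = (-b - D) / (2 * g x) := ⟨_, rfl⟩
    obtain ⟨t, ht⟩ : ∃ t, t = (-b + D) / (2 * g x) := ⟨_, rfl⟩
    have hst : s < t := by
      rw [hs, ht]
      gcongr
      linarith
    have hmul : s * t = g y / g x := by
      rw [hs, ht]
      field_simp
      linear_combination -hDsq
    have hneg : s * t < 0 := hmul ▸ div_neg_of_neg_of_pos hy hx
    have hs0 : s < 0 := by
      by_contra! hs0
      nlinarith
    have ht0 : 0 < t := by
      by_contra! ht0
      nlinarith
    have hgs : g (s • x + y) = 0 := by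
      rw [expand, ← hb, hs]
      field_simp
      linear_combination hDsq
    have hgt : g (t • x + y) = 0 := by
      rw [expand, ← hb, ht]
      field_simp
      linear_combination hDsq
    have hfs := h _ hgs.ge
    have hft := h _ hgt.ge
    rw [expand] at hfs hft
    have hprod : 0 ≤ (t - s) * (f y - s * t * f x) := by
      linear_combination
        mul_nonneg ht0.le hfs + mul_nonneg (neg_nonneg.2 hs0.le) hft
    have hfy : 0 ≤ f y - s * t * f x := nonneg_of_mul_nonneg_right hprod (sub_pos.2 hst)
    rw [hmul] at hfy
    rw [div_le_iff_of_neg hy]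
    calc f x / g x * g y = g y / g x * f x := by ring
      _ ≤ f y := by linarith
  obtain ⟨x₀, hx₀⟩ := hg
  have : Nonempty {x // 0 < g x} := ⟨⟨x₀, hx₀⟩⟩
  have hnonneg (x : {x // 0 < g x}) : 0 ≤ f x / g x := div_nonneg (h _ x.2.le) x.2.le
  refine ⟨⨅ x : {x // 0 < g x}, f x / g x, le_ciInf hnonneg, fun y => ?_⟩
  rcases lt_trichotomy (g y) 0 with hy | hy | hy
  · rw [← div_le_iff_of_neg hy]
    exact le_ciInf fun x => key x y x.2 hy
  · simpa [hy] using h y hy.ge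
  · rw [← le_div_iff₀ hy]
    exact ciInf_le ⟨0, Set.forall_mem_range.2 hnonneg⟩ (⟨y, hy⟩ : {x // 0 < g x})

theorem Matrix.toQuadraticForm'_apply_eq_dotProduct {m : Type*} [Fintype m] [DecidableEq m]
    (A : Matrix m m ℝ) (x : m → ℝ) : A.toQuadraticForm' x = x ⬝ᵥ A *ᵥ x := by
  rw [Matrix.toQuadraticForm', LinearMap.BilinMap.toQuadraticMap_apply, Matrix.toLinearMap₂'_apply']

theorem dotProduct_Jmat_mulVec (n : ℕ) [NeZero n] (x : Fin n → ℝ) :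
    x ⬝ᵥ Jmat n *ᵥ x = x 0 ^ 2 - ∑ i, if i = 0 then 0 else x i ^ 2 := by
  have h0 : x 0 ^ 2 = ∑ i, if i = 0 then x i ^ 2 else 0 := by simp
  rw [h0, ← Finset.sum_sub_distrib]
  refine Finset.sum_congr rfl fun i _ => ?_
  rw [Jmat, mulVec_diagonal]
  split_ifs <;> ring

theorem mem_soc_iff (n : ℕ) [NeZero n] (x : Fin n → ℝ) :
    x ∈ soc n ↔ 0 ≤ x 0 ∧ 0 ≤ x ⬝ᵥ Jmat n *ᵥ x := by
  rw [dotProduct_Jmat_mulVec, sub_nonneg]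
  exact Real.sqrt_le_iff

theorem stmt7 (n : ℕ) [NeZero n] (hn : 1 < n) (X : Matrix (Fin n) (Fin n) ℝ)
    (hX : Xᵀ = X) :
    (∀ x ∈ soc n, 0 ≤ x ⬝ᵥ X.mulVec x) ↔
      ∃ μ : ℝ, 0 ≤ μ ∧ (X - μ • Jmat n).PosSemidef := by
  have hform (μ : ℝ) (x : Fin n → ℝ) :
      x ⬝ᵥ (X - μ • Jmat n) *ᵥ x = x ⬝ᵥ X *ᵥ x - μ * (x ⬝ᵥ Jmat n *ᵥ x) := by
    rw [sub_mulVec, smul_mulVec, dotProduct_sub, dotProduct_smul, smul_eq_mul]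
  constructor
  · intro h
    obtain ⟨μ, hμ, hle⟩ := QuadraticForm.exists_nonneg_mul_le
      X.toQuadraticForm' (Jmat n).toQuadraticForm'
      (fun x hx => by
        rw [toQuadraticForm'_apply_eq_dotProduct] at hx ⊢
        rcases le_total 0 (x 0) with h0 | h0
        · exact h x ((mem_soc_iff n x).2 ⟨h0, hx⟩)
        · have := h (-x) ((mem_soc_iff n (-x)).2
            ⟨by simpa using h0, by simpa [mulVec_neg] using hx⟩)
          simpa [mulVec_neg] using this)
      ⟨Pi.single 0 1, by
        rw [toQuadraticForm'_apply_eq_dotProduct]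
        simp [Jmat]⟩
    refine ⟨μ, hμ, .of_dotProduct_mulVec_nonneg ?_ fun x => ?_⟩
    · simp [Matrix.IsHermitian, Jmat, conjTranspose_eq_transpose_of_trivial, hX]
    · have := hle x
      rw [toQuadraticForm'_apply_eq_dotProduct, toQuadraticForm'_apply_eq_dotProduct] at this
      rw [star_trivial, hform]
      linarith
  · rintro ⟨μ, hμ, hpsd⟩ x hx
    have hnonneg := hpsd.dotProduct_mulVec_nonneg x
    rw [star_trivial, hform] at hnonneg
    linarith [mul_nonneg hμ ((mem_soc_iff n x).1 hx).2]
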